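/- For the Takiff algebra q⟨m⟩ one has ind q⟨m⟩ = (m+1)·ind q, and consequently b(q⟨m⟩) = (m+1)·b(q), where b(q) = (dim q + ind q)/2. -/

import Mathlib

open Module

variable (k : Type*) [Field k]

/-- The Takiff bracket on `q⟨m⟩ = q ⊗ k[T]/(T^{m+1})`, as a bilinear map. -/
noncomputable def takiffBracketL (L : Type*) [LieRing L] [LieAlgebra k L] (m : ℕ) :
    (Fin (m + 1) → L) →ₗ[k] (Fin (m + 1) → L) →ₗ[k] (Fin (m + 1) → L) :=
  LinearMap.mk₂ k
    (fun x y l => ∑ i : Fin (m + 1), ∑ j : Fin (m + 1),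
      if (i : ℕ) + (j : ℕ) = (l : ℕ) then ⁅x i, y j⁆ else 0)
    (by intro x x' y; funext l
        simp only [Pi.add_apply, add_lie, ← Finset.sum_add_distrib, ite_add_ite, add_zero])
    (by intro c x y; funext l
        simp only [Pi.smul_apply, smul_lie, Finset.smul_sum, smul_ite, smul_zero])
    (by intro x y y'; funext l
        simp only [Pi.add_apply, lie_add, ← Finset.sum_add_distrib, ite_add_ite, add_zero])
    (by intro c x y; funext l
        simp only [Pi.smul_apply, lie_smul, Finset.smul_sum, smul_ite, smul_zero])

/-- The coadjoint stabiliser of `ξ ∈ q⟨m⟩*`. -/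
noncomputable def takiffStab {L : Type*} [LieRing L] [LieAlgebra k L] (m : ℕ)
    (ξ : Module.Dual k (Fin (m + 1) → L)) : Submodule k (Fin (m + 1) → L) :=
  LinearMap.ker ((takiffBracketL k L m).compr₂ ξ)

/-- The index of the Takiff algebra `q⟨m⟩`. -/
noncomputable def takiffIndex (L : Type*) [LieRing L] [LieAlgebra k L] (m : ℕ) : ℕ :=
  sInf {d : ℕ | ∃ ξ : Module.Dual k (Fin (m + 1) → L),
    d = Module.finrank k (takiffStab k m ξ)}

/-- The coadjoint stabiliser `q_ξ`. -/
noncomputable def coadStab {L : Type*} [LieRing L] [LieAlgebra k L]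
    (ξ : Module.Dual k L) : Submodule k L where
  carrier := {x : L | ∀ y : L, ξ ⁅x, y⁆ = 0}
  add_mem' := by intro a b ha hb y; simp [add_lie, ha y, hb y]
  zero_mem' := by intro y; simp
  smul_mem' := by intro c a ha y; simp [smul_lie, ha y]

/-- The index of `q`. -/
noncomputable def lieIndex (L : Type*) [LieRing L] [LieAlgebra k L] : ℕ :=
  sInf {d : ℕ | ∃ ξ : Module.Dual k L, d = Module.finrank k (coadStab k ξ)}

section PolynomialMatrix

open Polynomial

/-- Specialising a basis of `K[X]^ι` at a point gives a linearly independent family. -/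
theorem linearIndependent_eval_basis {K ι : Type*} [Field K] [Fintype ι] [DecidableEq ι]
    (b : Basis ι K[X] (ι → K[X])) (a : K) :
    LinearIndependent K (fun i q => (b i q).eval a) := by
  refine linearIndependent_of_top_le_span_of_card_eq_finrank ?_ (by simp)
  intro v _
  rw [Submodule.mem_span_range_iff_exists_fun]
  refine ⟨fun i => (b.repr (fun q => C (v q)) i).eval a, ?_⟩
  funext q
  have h := congrArg (eval a) (congrFun (b.sum_repr (fun q => C (v q))) q)
  simpa [Finset.sum_apply, eval_finsetSum] using h

/-- If all specialisations of a polynomial matrix have rank at most `r`, then its column module is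
generated by at most `r` elements. -/
theorem exists_span_eq_range_mulVecLin {K ι : Type*} [Field K] [Infinite K] [Fintype ι]
    [DecidableEq ι] (A : Matrix ι ι K[X]) (r : ℕ) (hA : ∀ a, (A.map (eval a)).rank ≤ r) :
    ∃ e ≤ r, ∃ c : Fin e → ι → K[X],
      LinearMap.range A.mulVecLin = Submodule.span K[X] (Set.range c) := by
  obtain ⟨e, S⟩ := Submodule.smithNormalForm (Pi.basisFun K[X] ι) (LinearMap.range A.mulVecLin)
  have hne : ∀ i, S.a i ≠ 0 := by
    intro i h
    have h' := S.snf i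
    rw [h, zero_smul] at h'
    exact S.bN.ne_zero i (Subtype.ext h')
  refine ⟨e, ?_, fun i => (S.bN i : ι → K[X]), ?_⟩
  · obtain ⟨a, ha⟩ : ∃ a, (∏ i, S.a i).eval a ≠ 0 := by
      by_contra! h
      exact Finset.prod_ne_zero_iff.mpr (fun i _ => hne i) (Polynomial.funext (by simpa using h))
    rw [eval_prod, Finset.prod_ne_zero_iff] at ha
    have hli : LinearIndependent K (fun i q => ((S.bN i : ι → K[X]) q).eval a) := by
      have h := ((linearIndependent_eval_basis S.bM a).comp S.f S.f.injective).units_smul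
        (fun i => Units.mk0 _ (ha i (Finset.mem_univ i)))
      convert h using 1
      funext i q
      simp [S.snf i, Units.smul_def]
    have hmem : ∀ i, (fun q => ((S.bN i : ι → K[X]) q).eval a) ∈
        LinearMap.range (A.map (eval a)).mulVecLin := by
      intro i
      obtain ⟨v, hv⟩ := (S.bN i).2
      refine ⟨fun p => (v p).eval a, ?_⟩
      funext q
      rw [← hv]
      simp [Matrix.mulVec, dotProduct, eval_finsetSum]
    have hcard := (LinearIndependent.of_comp (LinearMap.range (A.map (eval a)).mulVecLin).subtype
      (v := fun i => ⟨_, hmem i⟩) hli).fintype_card_le_finrank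
    simpa using hcard.trans (hA a)
  · have h := congrArg (Submodule.map (LinearMap.range A.mulVecLin).subtype) S.bN.span_eq
    rw [Submodule.map_span, ← Set.range_comp, Submodule.map_top, Submodule.range_subtype] at h
    exact h.symm

/-- The `m`-th coefficients of the products `X ^ j * w q` for `j ≤ m`; these determine `w` modulo
`X ^ (m + 1)`. -/
noncomputable def truncatedCoeff (K ι : Type*) [Field K] (m : ℕ) :
    (ι → K[X]) →ₗ[K] ((_ : Fin (m + 1)) × ι → K) where
  toFun w s := (X ^ (s.1 : ℕ) * w s.2).coeff m
  map_add' v w := by funext s; simp [mul_add]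
  map_smul' c w := by funext s; simp

theorem truncatedCoeff_X_pow_smul {K ι : Type*} [Field K] {m n : ℕ} (h : m < n) (w : ι → K[X]) :
    truncatedCoeff K ι m ((X ^ n : K[X]) • w) = 0 := by
  funext s
  simp only [truncatedCoeff, LinearMap.coe_mk, AddHom.coe_mk, Pi.smul_apply, smul_eq_mul,
    Pi.zero_apply, mul_left_comm _ (X ^ n : K[X])]
  rw [coeff_X_pow_mul', if_neg (by omega)]

theorem truncatedCoeff_mem_span {K ι : Type*} [Field K] {m e : ℕ} (c : Fin e → ι → K[X])
    {w : ι → K[X]} (hw : w ∈ Submodule.span K[X] (Set.range c)) :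
    truncatedCoeff K ι m w ∈ Submodule.span K (Set.range fun s : Fin (m + 1) × Fin e =>
      truncatedCoeff K ι m ((X ^ (s.1 : ℕ) : K[X]) • c s.2)) := by
  obtain ⟨f, rfl⟩ := (Submodule.mem_span_range_iff_exists_fun _).mp hw
  rw [map_sum]
  refine Submodule.sum_mem _ fun i _ => ?_
  rw [(f i).as_sum_range_C_mul_X_pow, Finset.sum_smul, map_sum]
  refine Submodule.sum_mem _ fun n _ => ?_
  rw [← smul_eq_C_mul, smul_assoc, map_smul]
  refine Submodule.smul_mem _ _ ?_
  by_cases h : m < n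
  · rw [truncatedCoeff_X_pow_smul h]
    exact Submodule.zero_mem _
  · exact Submodule.subset_span ⟨(⟨n, by omega⟩, i), rfl⟩

/-- The block Hankel matrix describing a polynomial matrix modulo `X ^ (m + 1)` has rank at most
`m + 1` times the generic rank. -/
theorem rank_truncated_le {K ι : Type*} [Field K] [Infinite K] [Fintype ι] [DecidableEq ι]
    (A : Matrix ι ι K[X]) (r m : ℕ) (hA : ∀ a, (A.map (eval a)).rank ≤ r) :
    (Matrix.of fun s t : (_ : Fin (m + 1)) × ι =>
      (X ^ (s.1 : ℕ) * (X ^ (t.1 : ℕ) * A s.2 t.2)).coeff m).rank ≤ (m + 1) * r := by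
  obtain ⟨e, he, c, hc⟩ := exists_span_eq_range_mulVecLin A r hA
  refine le_trans ?_ (Nat.mul_le_mul_left (m + 1) he)
  rw [Matrix.rank_eq_finrank_span_cols]
  have hle : Submodule.span K (Set.range (Matrix.of fun s t : (_ : Fin (m + 1)) × ι =>
      (X ^ (s.1 : ℕ) * (X ^ (t.1 : ℕ) * A s.2 t.2)).coeff m).col) ≤
      Submodule.span K (Set.range fun s : Fin (m + 1) × Fin e =>
        truncatedCoeff K ι m ((X ^ (s.1 : ℕ) : K[X]) • c s.2)) := by
    rw [Submodule.span_le]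
    rintro _ ⟨⟨i, p⟩, rfl⟩
    have hmem : (X ^ (i : ℕ) : K[X]) • A.col p ∈ Submodule.span K[X] (Set.range c) := by
      rw [← hc, Matrix.range_mulVecLin]
      exact Submodule.smul_mem _ _ (Submodule.subset_span ⟨p, rfl⟩)
    have hcol : (Matrix.of fun s t : (_ : Fin (m + 1)) × ι =>
        (X ^ (s.1 : ℕ) * (X ^ (t.1 : ℕ) * A s.2 t.2)).coeff m).col ⟨i, p⟩ =
        truncatedCoeff K ι m ((X ^ (i : ℕ) : K[X]) • A.col p) := by
      funext s
      simp only [Matrix.col_apply, Matrix.of_apply, truncatedCoeff, LinearMap.coe_mk,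
        AddHom.coe_mk, Pi.smul_apply, smul_eq_mul]
    rw [hcol]
    exact truncatedCoeff_mem_span c hmem
  refine (Submodule.finrank_mono hle).trans ((finrank_range_le_card _).trans ?_)
  simp

end PolynomialMatrix

/-- The rank of the Gram matrix of a bilinear form and the dimension of its radical add up to the
dimension of the space. -/
theorem rank_gram_add_finrank_ker {K V ι : Type*} [Field K] [AddCommGroup V] [Module K V]
    [Fintype ι] [DecidableEq ι] (b : Basis ι K V) (F : V →ₗ[K] Module.Dual K V) :
    (Matrix.of fun s t => F (b t) (b s)).rank + Module.finrank K (LinearMap.ker F) =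
      Module.finrank K V := by
  have : FiniteDimensional K V := b.finiteDimensional_of_finite
  have h : (Matrix.of fun s t => F (b t) (b s)) = LinearMap.toMatrix b b.dualBasis F := by
    ext s t
    simp [LinearMap.toMatrix_apply]
  rw [h, Matrix.rank_eq_finrank_range_toLin _ b.dualBasis b, Matrix.toLin_toMatrix]
  exact F.finrank_range_add_finrank_ker

section Takiff

variable {K L : Type*} [Field K] [LieRing L] [LieAlgebra K L]

theorem coadStab_eq_ker (ξ : Module.Dual K L) :
    coadStab K ξ = LinearMap.ker ((LieModule.toEnd K L L : L →ₗ[K] Module.End K L).compr₂ ξ) := by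
  ext x
  simp [coadStab, LinearMap.ext_iff]

theorem takiffBracketL_single (m : ℕ) (i j : Fin (m + 1)) (x y : L) :
    takiffBracketL K L m (Pi.single i x) (Pi.single j y) =
      fun l : Fin (m + 1) => if (i : ℕ) + (j : ℕ) = (l : ℕ) then ⁅x, y⁆ else 0 := by
  funext l
  simp only [takiffBracketL, LinearMap.mk₂_apply]
  rw [Finset.sum_eq_single i, Finset.sum_eq_single j]
  · simp
  · intro j' _ h
    simp [h]
  · simp
  · intro i' _ h
    simp [h]
  · simp

theorem takiffIndex_le [FiniteDimensional K L] (m : ℕ) (ξ : Module.Dual K L) :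
    takiffIndex K L m ≤ (m + 1) * Module.finrank K (coadStab K ξ) := by
  set η : Module.Dual K (Fin (m + 1) → L) := ξ ∘ₗ LinearMap.proj (Fin.last m)
  have hle : takiffStab K m η ≤ Submodule.pi Set.univ (fun _ => coadStab K ξ) := by
    intro x hx i _ y
    have h := LinearMap.congr_fun (LinearMap.mem_ker.mp hx) (Pi.single i.rev y)
    simp only [η, LinearMap.compr₂_apply, takiffBracketL, LinearMap.mk₂_apply, LinearMap.comp_apply,
      LinearMap.proj_apply, LinearMap.zero_apply] at h
    rw [Finset.sum_eq_single i, Finset.sum_eq_single i.rev] at h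
    · rw [if_pos (by simp [Fin.val_rev]; omega)] at h
      simpa using h
    · intro j _ hj
      simp [hj]
    · simp
    · intro i' _ hi'
      refine Finset.sum_eq_zero fun j _ => ?_
      by_cases hj : j = i.rev
      · subst hj
        rw [if_neg]
        intro h'
        apply hi'
        ext
        simp [Fin.val_rev] at h'
        omega
      · simp [hj]
    · simp
  have hpi : Module.finrank K (Submodule.pi Set.univ (fun _ : Fin (m + 1) => coadStab K ξ)) ≤
      (m + 1) * Module.finrank K (coadStab K ξ) := by
    let f : Submodule.pi Set.univ (fun _ : Fin (m + 1) => coadStab K ξ) →ₗ[K]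
        (Fin (m + 1) → coadStab K ξ) :=
      LinearMap.pi fun i => LinearMap.codRestrict _
        (LinearMap.proj i ∘ₗ Submodule.subtype _) fun x => x.2 i (Set.mem_univ i)
    have hf : Function.Injective f := by
      intro x y h
      ext i
      exact congrArg Subtype.val (congrFun h i)
    simpa [Module.finrank_pi_fintype] using LinearMap.finrank_le_finrank_of_injective hf
  have hmin : takiffIndex K L m ≤ Module.finrank K (takiffStab K m η) := Nat.sInf_le ⟨η, rfl⟩
  exact hmin.trans ((Submodule.finrank_mono hle).trans hpi)

open Polynomial in
theorem mul_lieIndex_le_finrank_takiffStab [Infinite K] [FiniteDimensional K L] (m : ℕ)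
    (ξ : Module.Dual K (Fin (m + 1) → L)) :
    (m + 1) * lieIndex K L ≤ Module.finrank K (takiffStab K m ξ) := by
  let b := Module.finBasis K L
  let A : Matrix (Fin (Module.finrank K L)) (Fin (Module.finrank K L)) K[X] := fun q p =>
    ∑ l : Fin (m + 1), C (ξ (Pi.single l ⁅b p, b q⁆)) * X ^ (m - (l : ℕ))
  have hA : ∀ a, (A.map (eval a)).rank ≤ Module.finrank K L - lieIndex K L := by
    intro a
    let ζ : Module.Dual K L :=
      ∑ l : Fin (m + 1), a ^ (m - (l : ℕ)) • (ξ ∘ₗ LinearMap.single K (fun _ => L) l)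
    have hrank := rank_gram_add_finrank_ker b
      ((LieModule.toEnd K L L : L →ₗ[K] Module.End K L).compr₂ ζ)
    rw [← coadStab_eq_ker] at hrank
    have hmin : lieIndex K L ≤ Module.finrank K (coadStab K ζ) := Nat.sInf_le ⟨ζ, rfl⟩
    have heq : A.map (eval a) = Matrix.of fun s t =>
        (LieModule.toEnd K L L : L →ₗ[K] Module.End K L).compr₂ ζ (b t) (b s) := by
      ext q p
      rw [Matrix.map_apply]
      simp only [A, ζ, Matrix.of_apply, eval_finsetSum, eval_mul, eval_C,
        eval_pow, eval_X, LinearMap.compr₂_apply, LinearMap.sum_apply, LinearMap.smul_apply,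
        LinearMap.comp_apply, LinearMap.single_apply, smul_eq_mul]
      exact Finset.sum_congr rfl fun l _ => mul_comm _ _
    rw [heq]
    omega
  have hrank := rank_truncated_le A _ m hA
  have hgram := rank_gram_add_finrank_ker (Pi.basis fun _ : Fin (m + 1) => b)
    ((takiffBracketL K L m).compr₂ ξ)
  have heq : (Matrix.of fun s t : (_ : Fin (m + 1)) × Fin (Module.finrank K L) =>
      (X ^ (s.1 : ℕ) * (X ^ (t.1 : ℕ) * A s.2 t.2)).coeff m) =
      Matrix.of fun s t => (takiffBracketL K L m).compr₂ ξ
        (Pi.basis (fun _ : Fin (m + 1) => b) t) (Pi.basis (fun _ : Fin (m + 1) => b) s) := by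
    ext ⟨j, q⟩ ⟨i, p⟩
    have hsum : (fun l : Fin (m + 1) => if (i : ℕ) + (j : ℕ) = (l : ℕ) then ⁅b p, b q⁆ else 0) =
        ∑ l : Fin (m + 1), if (i : ℕ) + (j : ℕ) = (l : ℕ) then Pi.single l ⁅b p, b q⁆ else 0 := by
      funext l
      rw [Finset.sum_apply, Finset.sum_eq_single l]
      · split_ifs <;> simp
      · intro l' _ h
        split_ifs <;> simp [h.symm]
      · simp
    simp only [Matrix.of_apply, LinearMap.compr₂_apply, Pi.basis_apply, takiffBracketL_single,
      hsum, map_sum, A, Finset.mul_sum, finsetSum_coeff]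
    refine Finset.sum_congr rfl fun l _ => ?_
    rw [← mul_assoc, ← pow_add, mul_left_comm, ← pow_add, coeff_C_mul, coeff_X_pow]
    have hl := l.is_le
    by_cases h : (i : ℕ) + (j : ℕ) = (l : ℕ)
    · rw [if_pos h, if_pos (by omega), mul_one]
    · rw [if_neg h, if_neg (by omega), mul_zero, map_zero]
  rw [← heq] at hgram
  have hdim : Module.finrank K (Fin (m + 1) → L) = (m + 1) * Module.finrank K L := by
    simp [Module.finrank_pi_fintype]
  have hmin : lieIndex K L ≤ Module.finrank K (coadStab K (0 : Module.Dual K L)) :=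
    Nat.sInf_le ⟨0, rfl⟩
  have hle : lieIndex K L ≤ Module.finrank K L := hmin.trans (Submodule.finrank_le _)
  rw [Nat.mul_sub] at hrank
  have := Nat.mul_le_mul_left (m + 1) hle
  unfold takiffStab
  omega

theorem takiffIndex_eq [Infinite K] [FiniteDimensional K L] (m : ℕ) :
    takiffIndex K L m = (m + 1) * lieIndex K L := by
  apply le_antisymm
  · obtain ⟨ξ, hξ⟩ := Nat.sInf_mem (s := {d : ℕ | ∃ ξ : Module.Dual K L,
      d = Module.finrank K (coadStab K ξ)}) ⟨_, 0, rfl⟩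
    unfold lieIndex
    rw [hξ]
    exact takiffIndex_le m ξ
  · obtain ⟨ξ, hξ⟩ := Nat.sInf_mem (s := {d : ℕ | ∃ ξ : Module.Dual K (Fin (m + 1) → L),
      d = Module.finrank K (takiffStab K m ξ)}) ⟨_, 0, rfl⟩
    unfold takiffIndex
    rw [hξ]
    exact mul_lieIndex_le_finrank_takiffStab m ξ

end Takiff

/-- Raïs–Tauvel: `ind q⟨m⟩ = (m+1)·ind q`, and consequently
`b(q⟨m⟩) = (m+1)·b(q)` where `b(q) = (dim q + ind q)/2`. -/
theorem takiff_index_and_magic (L : Type*) [Field k] [IsAlgClosed k] [CharZero k]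
    [LieRing L] [LieAlgebra k L] [FiniteDimensional k L] (m : ℕ) :
    takiffIndex k L m = (m + 1) * lieIndex k L ∧
    Module.finrank k (Fin (m + 1) → L) + takiffIndex k L m =
      (m + 1) * (Module.finrank k L + lieIndex k L) := by
  have : Infinite k := IsAlgClosed.instInfinite
  have h : takiffIndex k L m = (m + 1) * lieIndex k L := takiffIndex_eq m
  refine ⟨h, ?_⟩
  rw [h, mul_add]
  simp [Module.finrank_pi_fintype]
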